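/- arXiv:2604.09676 — 3 statements merged into one kernel-verified Lean document; each statement's English description precedes it below -/
import Mathlib

section
/- Let A be a finite nonempty type, and for logits z : A → ℝ let π_z(a) = exp(z a) / ∑_{a'} exp(z a') be the softmax policy, and let H(z) = -∑_a π_z(a) · log π_z(a) be its Shannon entropy. Then for every a ∈ A, the function z ↦ H(z) has partial derivative with respect to the coordinate z_a equal to -π_z(a) · (log π_z(a) - ∑_{a'} π_z(a') · log π_z(a')). -/
/-- Softmax policy induced by logits `z`. -/
noncomputable def softmax {A : Type*} [Fintype A] (z : A → ℝ) (a : A) : ℝ :=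
  Real.exp (z a) / ∑ a', Real.exp (z a')

/-- Shannon entropy of the softmax policy. -/
noncomputable def entropy {A : Type*} [Fintype A] (z : A → ℝ) : ℝ :=
  -∑ a, softmax z a * Real.log (softmax z a)

theorem sum_exp_pos {A : Type*} [Fintype A] [Nonempty A] (z : A → ℝ) :
    0 < ∑ a, Real.exp (z a) :=
  Finset.sum_pos (fun a _ => Real.exp_pos (z a)) Finset.univ_nonempty

theorem log_softmax {A : Type*} [Fintype A] [Nonempty A] (z : A → ℝ) (a : A) :
    Real.log (softmax z a) = z a - Real.log (∑ a', Real.exp (z a')) := by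
  rw [softmax, Real.log_div (Real.exp_pos _).ne' (sum_exp_pos z).ne', Real.log_exp]

theorem sum_softmax_mul_log_softmax {A : Type*} [Fintype A] [Nonempty A] (z : A → ℝ) :
    ∑ a, softmax z a * Real.log (softmax z a) =
      (∑ a, Real.exp (z a) * z a) / (∑ a, Real.exp (z a)) -
        Real.log (∑ a, Real.exp (z a)) := by
  have h := (sum_exp_pos z).ne'
  simp only [log_softmax, mul_sub, Finset.sum_sub_distrib, ← Finset.sum_mul]
  simp only [softmax, div_mul_eq_mul_div, ← Finset.sum_div]
  rw [mul_div_cancel_left₀ _ h]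

/-- The partial derivative of the entropy of the softmax policy with respect to the
coordinate `z a` equals `-π_z(a) · (log π_z(a) - ∑_{a'} π_z(a') log π_z(a'))`. -/
theorem entropy_partialDeriv {A : Type*} [Fintype A] [Nonempty A] [DecidableEq A]
    (z : A → ℝ) (a : A) :
    HasDerivAt
      (fun t : ℝ => entropy (z + t • fun a' => if a' = a then (1 : ℝ) else 0))
      (-(softmax z a *
        (Real.log (softmax z a) - ∑ a', softmax z a' * Real.log (softmax z a')))) 0 := by
  have hz (b : A) : HasDerivAt
      (fun t : ℝ => (z + t • fun a' => if a' = a then (1 : ℝ) else 0) b)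
      (if b = a then 1 else 0) 0 := by
    simpa using ((hasDerivAt_id (0 : ℝ)).mul_const (if b = a then (1 : ℝ) else 0)).const_add (z b)
  have hS := HasDerivAt.fun_sum (u := Finset.univ) fun b _ => (hz b).exp
  have hM := HasDerivAt.fun_sum (u := Finset.univ) fun b _ => (hz b).exp.fun_mul (hz b)
  have hpos := (sum_exp_pos z).ne'
  have h0 : ∑ b, Real.exp ((z + (0 : ℝ) • fun a' => if a' = a then (1 : ℝ) else 0) b) ≠ 0 :=
    (sum_exp_pos _).ne'
  have hH := ((hM.fun_div hS h0).fun_sub (hS.log h0)).fun_neg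
  simp only [entropy, sum_softmax_mul_log_softmax]
  rw [log_softmax]
  refine hH.congr_deriv ?_
  simp only [zero_smul, add_zero, mul_ite, mul_one, mul_zero, ite_mul, zero_mul,
    Finset.sum_add_distrib, Finset.sum_ite_eq', Finset.mem_univ, if_true, softmax]
  field_simp
  ring
end

section
/- Let A be a finite nonempty type, and for logits z : A → ℝ let π_z(a) = exp(z a) / ∑_{a'} exp(z a') be the softmax policy, and let H(z) = -∑_a π_z(a) · log π_z(a) be its entropy. Then the Fréchet derivative of z ↦ H(z) at z, applied to any direction Δ : A → ℝ, equals -Cov_{π_z}(a ↦ log π_z(a), a ↦ Δ(a)), where Cov_p(f, g) = ∑_a p(a) · (f(a) - ∑_{a'} p(a') f(a')) · (g(a) - ∑_{a'} p(a') g(a')). -/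
/-- Covariance of `f` and `g` under the probability vector `p`. -/
noncomputable def cov {A : Type*} [Fintype A] (p f g : A → ℝ) : ℝ :=
  ∑ a, p a * (f a - ∑ a', p a' * f a') * (g a - ∑ a', p a' * g a')

theorem softmax_pos {A : Type*} [Fintype A] [Nonempty A] (z : A → ℝ) (a : A) :
    0 < softmax z a :=
  div_pos (Real.exp_pos _) (sum_exp_pos z)

theorem sum_softmax {A : Type*} [Fintype A] [Nonempty A] (z : A → ℝ) :
    ∑ a, softmax z a = 1 := by
  simp only [softmax, ← Finset.sum_div]
  exact div_self (sum_exp_pos z).ne'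

theorem hasFDerivAt_softmax {A : Type*} [Fintype A] [Nonempty A] (z : A → ℝ) (a : A) :
    HasFDerivAt (fun w => softmax w a)
      (softmax z a • (ContinuousLinearMap.proj (R := ℝ) (φ := fun _ : A => ℝ) a -
        ∑ b, softmax z b • ContinuousLinearMap.proj (R := ℝ) (φ := fun _ : A => ℝ) b)) z := by
  have hexp (b : A) := (hasFDerivAt_apply (𝕜 := ℝ) (F' := fun _ : A => ℝ) b z).exp
  have hS := (sum_exp_pos z).ne'
  have hsum := HasFDerivAt.fun_sum fun b (_ : b ∈ Finset.univ) => hexp b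
  have h := (hexp a).fun_mul ((hasDerivAt_inv hS).comp_hasFDerivAt z hsum)
  simp only [Function.comp_apply, ← div_eq_mul_inv] at h
  refine h.congr_fderiv ?_
  ext v
  simp only [softmax, smul_apply, add_apply, sub_apply, sum_apply,
    ContinuousLinearMap.proj_apply, smul_eq_mul, div_mul_eq_mul_div, ← Finset.sum_div]
  field_simp
  ring

/-- The covariance needs only one of its arguments to be centered. -/
theorem cov_eq_sum_mul_sub {A : Type*} [Fintype A] {p : A → ℝ} (hp : ∑ a, p a = 1)
    (f g : A → ℝ) :
    cov p f g = ∑ a, p a * f a * (g a - ∑ a', p a' * g a') := by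
  have hg : ∑ a, p a * (g a - ∑ a', p a' * g a') = 0 := by
    simp [mul_sub, Finset.sum_sub_distrib, ← Finset.sum_mul, hp]
  rw [cov, ← sub_eq_zero, ← Finset.sum_sub_distrib, ← neg_eq_zero, ← Finset.sum_neg_distrib]
  calc _ = (∑ a', p a' * f a') * ∑ a, p a * (g a - ∑ a', p a' * g a') := by
        rw [Finset.mul_sum]
        exact Finset.sum_congr rfl fun a _ => by ring
    _ = 0 := by rw [hg, mul_zero]

/-- The Fréchet derivative of the entropy at `z`, applied to a direction `Δ`,
equals `-Cov_{π_z}(log π_z, Δ)`. -/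
theorem fderiv_entropy_apply {A : Type*} [Fintype A] [Nonempty A]
    (z Δ : A → ℝ) :
    fderiv ℝ entropy z Δ = -cov (softmax z) (fun a => Real.log (softmax z a)) Δ := by
  have hH : HasFDerivAt entropy _ z :=
    (HasFDerivAt.fun_sum fun a (_ : a ∈ Finset.univ) =>
      (hasFDerivAt_softmax z a).fun_mul
        ((hasFDerivAt_softmax z a).log (softmax_pos z a).ne')).fun_neg
  have hcov_one : cov (softmax z) (fun _ => 1) Δ = 0 := by
    simp [cov, sum_softmax]
  rw [cov_eq_sum_mul_sub (sum_softmax z)] at hcov_one ⊢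
  rw [hH.fderiv, ← add_zero (∑ a, softmax z a * _ * _), ← hcov_one, ← Finset.sum_add_distrib]
  simp only [neg_apply, sum_apply, add_apply, smul_apply, sub_apply,
    ContinuousLinearMap.proj_apply, smul_eq_mul]
  congr 1
  refine Finset.sum_congr rfl fun a _ => ?_
  have := (softmax_pos z a).ne'
  field_simp
  ring
end

section
/- Let E be a real Hilbert space, f : E → ℝ differentiable with L-Lipschitz gradient (L > 0), bounded above, and let 0 < η ≤ 1/L. Define the gradient ascent iterates x_{t+1} = x_t + η · ∇f(x_t) from an initial point x_0. Then ‖∇f(x_t)‖ → 0 as t → ∞, and every cluster point x* of the sequence (x_t) satisfies ∇f(x*) = 0, i.e., x* is a stationary point of f. -/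
open Filter Topology

/-- The quadratic lower bound for a function whose gradient is `L`-Lipschitz. -/
theorem HasGradientAt.quadratic_lower_bound_of_lipschitz {E : Type*} [NormedAddCommGroup E]
    [InnerProductSpace ℝ E] [CompleteSpace E] {f : E → ℝ} {f' : E → E} {L : ℝ}
    (hgrad : ∀ x, HasGradientAt f (f' x) x)
    (hlip : ∀ x y, ‖f' x - f' y‖ ≤ L * ‖x - y‖) (x v : E) :
    f x + inner ℝ (f' x) v - L / 2 * ‖v‖ ^ 2 ≤ f (x + v) := by
  have hline (s : ℝ) :
      HasDerivAt (fun s : ℝ => -f (x + s • v)) (-inner ℝ (f' (x + s • v)) v) s := by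
    have hp : HasDerivAt (fun s : ℝ => x + s • v) v s := by
      simpa using ((hasDerivAt_id s).smul_const v).const_add x
    have h := ((hgrad (x + s • v)).hasFDerivAt.comp_hasDerivAt s hp).neg
    exact h.congr_deriv (by simp)
  have hquad (s : ℝ) :
      HasDerivAt (fun s : ℝ => -f x - s * inner ℝ (f' x) v + L / 2 * ‖v‖ ^ 2 * s ^ 2)
        (-inner ℝ (f' x) v + L * ‖v‖ ^ 2 * s) s := by
    have h := (((hasDerivAt_id s).mul_const (inner ℝ (f' x) v)).const_sub (-f x)).add
      ((hasDerivAt_pow 2 s).const_mul (L / 2 * ‖v‖ ^ 2))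
    exact h.congr_deriv (by push_cast; ring)
  have hbound (s : ℝ) (hs : 0 ≤ s) :
      -inner ℝ (f' (x + s • v)) v ≤ -inner ℝ (f' x) v + L * ‖v‖ ^ 2 * s := by
    have h₁ : inner ℝ (f' x - f' (x + s • v)) v ≤ L * ‖v‖ ^ 2 * s := by
      calc inner ℝ (f' x - f' (x + s • v)) v
          ≤ ‖f' x - f' (x + s • v)‖ * ‖v‖ := real_inner_le_norm _ _
        _ ≤ L * ‖x - (x + s • v)‖ * ‖v‖ := by gcongr; exact hlip _ _
        _ = L * ‖v‖ ^ 2 * s := by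
          rw [sub_add_cancel_left, norm_neg, norm_smul, Real.norm_of_nonneg hs]
          ring
    rw [inner_sub_left] at h₁
    linarith
  have h := image_le_of_deriv_right_le_deriv_boundary (a := 0) (b := 1)
    (fun s _ => (hline s).continuousAt.continuousWithinAt)
    (fun s _ => (hline s).hasDerivWithinAt) (by simp)
    (fun s _ => (hquad s).continuousAt.continuousWithinAt)
    (fun s _ => (hquad s).hasDerivWithinAt) (fun s hs => hbound s hs.1)
    (Set.right_mem_Icc.2 zero_le_one)
  simp only [one_smul, one_mul, one_pow, mul_one] at h
  linarith

/-- One gradient ascent step of size `η ≤ 1 / L` increases `f` by at least `η / 2 * ‖∇f‖ ^ 2`. -/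
theorem HasGradientAt.le_apply_add_smul_of_lipschitz {E : Type*} [NormedAddCommGroup E]
    [InnerProductSpace ℝ E] [CompleteSpace E] {f : E → ℝ} {f' : E → E} {L η : ℝ} (hL : 0 < L)
    (hgrad : ∀ x, HasGradientAt f (f' x) x)
    (hlip : ∀ x y, ‖f' x - f' y‖ ≤ L * ‖x - y‖) (hη : 0 < η) (hηL : η ≤ 1 / L) (x : E) :
    f x + η / 2 * ‖f' x‖ ^ 2 ≤ f (x + η • f' x) := by
  have h := HasGradientAt.quadratic_lower_bound_of_lipschitz hgrad hlip x (η • f' x)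
  rw [real_inner_smul_right, real_inner_self_eq_norm_sq, norm_smul,
    Real.norm_of_nonneg hη.le] at h
  have hLη : η * L ≤ 1 := (le_div_iff₀ hL).1 hηL
  have : 0 ≤ η * ‖f' x‖ ^ 2 * (1 - η * L) :=
    mul_nonneg (by positivity) (sub_nonneg.2 hLη)
  nlinarith

/-- Convergence of gradient ascent to stationary points: for `f` differentiable on a
real Hilbert space with `L`-Lipschitz gradient and bounded above, step size
`0 < η ≤ 1/L`, and iterates `x_{t+1} = x_t + η • ∇f(x_t)`, the gradient norms tend to
zero and every cluster point of the iterates is a stationary point of `f`. -/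
theorem gradient_ascent_stationary {E : Type*} [NormedAddCommGroup E]
    [InnerProductSpace ℝ E] [CompleteSpace E]
    (f : E → ℝ) (f' : E → E) (L : ℝ) (hL : 0 < L)
    (hgrad : ∀ x, HasGradientAt f (f' x) x)
    (hlip : ∀ x y, ‖f' x - f' y‖ ≤ L * ‖x - y‖)
    (M : ℝ) (hM : ∀ y, f y ≤ M)
    (η : ℝ) (hη : 0 < η) (hηL : η ≤ 1 / L)
    (x : ℕ → E) (hx : ∀ t, x (t + 1) = x t + η • f' (x t)) :
    Tendsto (fun t => ‖f' (x t)‖) atTop (𝓝 0) ∧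
      ∀ xstar : E,
        (∃ φ : ℕ → ℕ, StrictMono φ ∧ Tendsto (fun n => x (φ n)) atTop (𝓝 xstar)) →
        f' xstar = 0 := by
  have hstep (t : ℕ) : f (x t) + η / 2 * ‖f' (x t)‖ ^ 2 ≤ f (x (t + 1)) := by
    rw [hx t]
    exact HasGradientAt.le_apply_add_smul_of_lipschitz hL hgrad hlip hη hηL (x t)
  have hmono : Monotone fun t => f (x t) := monotone_nat_of_le_succ fun t =>
    (le_add_of_nonneg_right (by positivity)).trans (hstep t)
  have hlim := tendsto_atTop_ciSup hmono ⟨M, by rintro _ ⟨t, rfl⟩; exact hM _⟩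
  have hdiff : Tendsto (fun t => 2 / η * (f (x (t + 1)) - f (x t))) atTop (𝓝 0) := by
    simpa using (((tendsto_add_atTop_iff_nat 1).2 hlim).sub hlim).const_mul (2 / η)
  have hsq : Tendsto (fun t => ‖f' (x t)‖ ^ 2) atTop (𝓝 0) := by
    refine squeeze_zero (fun t => by positivity) (fun t => ?_) hdiff
    rw [div_mul_eq_mul_div, le_div_iff₀ hη]
    linarith [hstep t]
  have hnorm : Tendsto (fun t => ‖f' (x t)‖) atTop (𝓝 0) := by
    simpa [Real.sqrt_sq] using hsq.sqrt
  refine ⟨hnorm, ?_⟩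
  rintro xstar ⟨φ, hφ, hconv⟩
  have hcont : Continuous f' :=
    (LipschitzWith.of_dist_le_mul (K := L.toNNReal) fun a b => by
      simpa only [dist_eq_norm, Real.coe_toNNReal L hL.le] using hlip a b).continuous
  exact tendsto_nhds_unique ((hcont.tendsto xstar).comp hconv)
    ((tendsto_zero_iff_norm_tendsto_zero.2 hnorm).comp hφ.tendsto_atTop)
end
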